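/- Let X ⊆ Z, let M₁ be a perfect matching of H(X) and let M₂ be a perfect matching of H(Z∖X). Then every connected component of the graph with edge set M₁ Δ M₂ that contains an edge is either a cycle avoiding all terminal centers or a simple path whose two endpoints are terminal centers, and every center h(z), z ∈ Z, is an endpoint of exactly one such path. Moreover: (i) the set of edges e of G whose external edge lies on a path-component of M₁ Δ M₂ is the union of the edge sets of |Z|/2 pairwise vertex-disjoint simple paths in G whose endpoints are exactly the vertices of Z, the path arising from a Δ-path joining h(z) and h(z′) having endpoints z and z′; (ii) the set of edges of G whose external edge lies on a cycle-component of M₁ Δ M₂ is the union of the edge sets of pairwise vertex-disjoint cycles in G, vertex-disjoint from the paths in (i); and (iii) if every path-component of M₁ Δ M₂ has both endpoints in {h(a) : a ∈ A} or both endpoints in {h(b) : b ∈ B}, then the edge set in (i) is a solution to Disjoint A,B-paths on G. -/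

import Mathlib

/-- `f` is a family of `(|A|+|B|)/2` pairwise vertex-disjoint simple paths of `G`,
each with both endpoints in `A` or both endpoints in `B`, such that every vertex of
`A ∪ B` is an endpoint of one of the paths, and `E'` is the union of their edge
sets.  This witnesses that `E'` is a solution to Disjoint `A`,`B`-paths. -/
def IsPathFamily {V : Type} [DecidableEq V] (G : SimpleGraph V) (A B : Finset V)
    (E' : Set (Sym2 V)) {k : ℕ} (f : Fin k → (u : V) × (v : V) × G.Walk u v) : Prop :=
  k = (A.card + B.card) / 2 ∧
  (∀ i, (f i).2.2.IsPath) ∧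
  (∀ i, ((f i).1 ∈ A ∧ (f i).2.1 ∈ A) ∨ ((f i).1 ∈ B ∧ (f i).2.1 ∈ B)) ∧
  (∀ i j, i ≠ j → ∀ x, x ∈ (f i).2.2.support → x ∉ (f j).2.2.support) ∧
  (∀ z, z ∈ A ∪ B → ∃ i, z = (f i).1 ∨ z = (f i).2.1) ∧
  E' = ⋃ i, {e | e ∈ (f i).2.2.edges}

/-- `E'` is a solution to Disjoint `A`,`B`-paths on `G`. -/
def IsSolution {V : Type} [DecidableEq V] (G : SimpleGraph V) (A B : Finset V)
    (E' : Set (Sym2 V)) : Prop :=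
  ∃ (k : ℕ) (f : Fin k → (u : V) × (v : V) × G.Walk u v), IsPathFamily G A B E' f

/-- The length of an edge set: the sum of the lengths of its edges. -/
noncomputable def lengthOf {V : Type} (ℓ : Sym2 V → ℕ) (E' : Set (Sym2 V)) : ℕ :=
  ∑ᶠ e ∈ E', ℓ e

/-- `ℓ_{A,B}`: the minimum length of a solution to Disjoint `A`,`B`-paths. -/
noncomputable def lAB {V : Type} [DecidableEq V] (G : SimpleGraph V) (A B : Finset V)
    (ℓ : Sym2 V → ℕ) : ℕ :=
  sInf {n | ∃ E', IsSolution G A B E' ∧ lengthOf ℓ E' = n}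

/-- `S_{A,B}`: the number of minimum-length solutions to Disjoint `A`,`B`-paths. -/
noncomputable def nSol {V : Type} [DecidableEq V] (G : SimpleGraph V) (A B : Finset V)
    (ℓ : Sym2 V → ℕ) : ℕ :=
  Set.ncard {E' | IsSolution G A B E' ∧ lengthOf ℓ E' = lAB G A B ℓ}


/-- The vertex type of the gadget graph `H`: `Sum.inl (v, i)` is the gadget vertex
`hᵢ(v)` and `Sum.inr z` is the terminal center `h(z)` (used only for `z ∈ Z`). -/
abbrev HVert (V : Type) : Type := (V × Fin 3) ⊕ V

/-- Base relation for the gadget graph `H`: triangle edges inside nonterminal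
gadgets, star edges inside terminal gadgets, and external edges between gadgets
(one external edge `h_{idx u (uv)}(u) h_{idx v (uv)}(v)` for every edge `uv` of `G`). -/
def hRel {V : Type} (G : SimpleGraph V) (idx : V → Sym2 V → Fin 3) (Z : Finset V) :
    HVert V → HVert V → Prop
  | .inl (u, i), .inl (w, j) =>
      (u = w ∧ u ∉ Z ∧ i ≠ j) ∨
      (G.Adj u w ∧ idx u s(u, w) = i ∧ idx w s(u, w) = j)
  | .inr z, .inl (w, _) => z ∈ Z ∧ z = w
  | _, _ => False

/-- The gadget graph `H` (with terminal set `Z`). -/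
def gadgetGraph {V : Type} (G : SimpleGraph V) (idx : V → Sym2 V → Fin 3)
    (Z : Finset V) : SimpleGraph (HVert V) :=
  SimpleGraph.fromRel (hRel G idx Z)

/-- The vertex set of `H(X)`: all gadget vertices, and the centers `h(z)` for `z ∈ X`. -/
def gadgetVerts {V : Type} (X : Finset V) : Set (HVert V) :=
  fun x => match x with
  | .inl _ => True
  | .inr z => z ∈ X

/-- `M` is (the edge set of) a perfect matching of `H(X)`. -/
def IsPMgadget {V : Type} (G : SimpleGraph V) (idx : V → Sym2 V → Fin 3)
    (Z X : Finset V) (M : Finset (Sym2 (HVert V))) : Prop :=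
  (∀ e ∈ M, e ∈ (gadgetGraph G idx Z).edgeSet ∧ ∀ x ∈ e, x ∈ gadgetVerts X) ∧
  (∀ x ∈ gadgetVerts X, ∃! e, e ∈ M ∧ x ∈ e)

/-- The endpoint, in the gadget of `u`, of the external edge of `H` representing the
edge `uv'` of `G`; this is `f(uv') = h_{idx u (uv')}(u)`. -/
def fEnd {V : Type} (idx : V → Sym2 V → Fin 3) (u v' : V) : HVert V :=
  Sum.inl (u, idx u s(u, v'))

/-- The external edge of `H` representing an edge of `G`. -/
def extEdge {V : Type} (idx : V → Sym2 V → Fin 3) : Sym2 V → Sym2 (HVert V) :=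
  Sym2.lift ⟨fun u v => s(fEnd idx u v, fEnd idx v u), by
    intro u v
    exact Sym2.eq_swap⟩

open Classical in
/-- The weight of an edge of `H`: `s ^ ℓ(e)` for the external edge representing the
edge `e` of `G`, and `1` for internal edges (as a polynomial in `ℤ[s]`). -/
noncomputable def wt {V : Type} (G : SimpleGraph V) (ℓ : Sym2 V → ℕ)
    (idx : V → Sym2 V → Fin 3) (ε : Sym2 (HVert V)) : Polynomial ℤ :=
  if h : ∃ e, e ∈ G.edgeSet ∧ ε = extEdge idx e then Polynomial.X ^ ℓ h.choose else 1

open Classical in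
/-- `pm(H(X))`: the sum of the weights of all perfect matchings of `H(X)`. -/
noncomputable def pmPoly {V : Type} [Fintype V] [DecidableEq V] (G : SimpleGraph V)
    (ℓ : Sym2 V → ℕ) (idx : V → Sym2 V → Fin 3) (Z X : Finset V) : Polynomial ℤ :=
  ∑ M ∈ Finset.univ.filter (fun M : Finset (Sym2 (HVert V)) => IsPMgadget G idx Z X M),
    ∏ e ∈ M, wt G ℓ idx e

open Classical in
/-- The polynomial `p(G,s) = Σ_{X ⊆ Z} (−1)^{|X∩A|} pm(H(X)) pm(H(Z∖X))`. -/
noncomputable def pPoly {V : Type} [Fintype V] [DecidableEq V] (G : SimpleGraph V)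
    (A B : Finset V) (ℓ : Sym2 V → ℕ) (idx : V → Sym2 V → Fin 3) : Polynomial ℤ :=
  ∑ X ∈ (A ∪ B).powerset,
    (-1 : Polynomial ℤ) ^ (X ∩ A).card *
      (pmPoly G ℓ idx (A ∪ B) X * pmPoly G ℓ idx (A ∪ B) ((A ∪ B) \ X))

/-- `Λ`: the total length of all edges of `G`. -/
noncomputable def totalLen {V : Type} (G : SimpleGraph V) (ℓ : Sym2 V → ℕ) : ℕ :=
  ∑ᶠ e ∈ G.edgeSet, ℓ e

/-- The edges of the connected component of `x` in the graph `D`. -/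
def compEdges {V : Type} (D : SimpleGraph V) (x : V) : Set (Sym2 V) :=
  {e | e ∈ D.edgeSet ∧ ∃ y ∈ e, D.Reachable x y}

namespace SimpleGraph

/-- Vertices of `T` have exactly one neighbour; all others have none or exactly two. -/
structure IsPathCycleGraph {W : Type} (D : SimpleGraph W) (T : Set W) : Prop where
  one : ∀ x ∈ T, ∃ y, ∀ w, D.Adj x w ↔ w = y
  two : ∀ x ∉ T, (∀ w, ¬ D.Adj x w) ∨ ∃ y z, y ≠ z ∧ ∀ w, D.Adj x w ↔ w = y ∨ w = z

/-- A walk using every edge that meets its support. -/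
def Walk.IsSpanning {W : Type} {D : SimpleGraph W} {x y : W} (p : D.Walk x y) : Prop :=
  ∀ w ∈ p.support, ∀ u, D.Adj w u → s(w, u) ∈ p.edges

namespace Walk.IsSpanning

variable {W : Type} {D : SimpleGraph W} {x y : W} {p : D.Walk x y}

theorem mem_support_iff (hp : p.IsSpanning) {w : W} : w ∈ p.support ↔ D.Reachable x w := by
  classical
  constructor
  · intro hw
    exact ⟨p.takeUntil w hw⟩
  · rintro ⟨q⟩
    suffices ∀ {a b : W} (q : D.Walk a b), a ∈ p.support → b ∈ p.support from
      this q p.start_mem_support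
    intro a b q
    induction q with
    | nil => exact id
    | cons h q ih => exact fun ha => ih (p.snd_mem_support_of_mem_edges (hp _ ha _ h))

theorem edges_eq_compEdges (hp : p.IsSpanning) : {e | e ∈ p.edges} = compEdges D x := by
  ext e
  induction e using Sym2.ind with | _ a b =>
  constructor
  · intro he
    exact ⟨p.edges_subset_edgeSet he, a, by simp,
      hp.mem_support_iff.1 (p.fst_mem_support_of_mem_edges he)⟩
  · rintro ⟨he, c, hc, hr⟩
    rw [Sym2.mem_iff] at hc
    rcases hc with rfl | rfl
    · exact hp _ (hp.mem_support_iff.2 hr) _ he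
    · have := hp _ (hp.mem_support_iff.2 hr) _ (D.adj_symm he)
      rwa [Sym2.eq_swap] at this

end Walk.IsSpanning

theorem Walk.IsPath.exists_longest {W : Type} [Finite W] (D : SimpleGraph W) (x : W) :
    ∃ (y : W) (p : D.Walk x y), p.IsPath ∧
      ∀ (y' : W) (q : D.Walk x y'), q.IsPath → q.length ≤ p.length := by
  have := Fintype.ofFinite W
  let S : Set ℕ := {n | ∃ (y : W) (p : D.Walk x y), p.IsPath ∧ p.length = n}
  have hne : S.Nonempty := ⟨0, x, Walk.nil, Walk.IsPath.nil, rfl⟩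
  have hb : BddAbove S := ⟨Fintype.card W, by rintro n ⟨y, p, hp, rfl⟩; exact hp.length_lt.le⟩
  obtain ⟨y, p, hp, hl⟩ := Nat.sSup_mem hne hb
  exact ⟨y, p, hp, fun y' q hq => hl ▸ le_csSup hb ⟨y', q, hq, rfl⟩⟩

namespace IsPathCycleGraph

variable {W : Type} {D : SimpleGraph W} {T : Set W}

theorem exists_path [Finite W] (h : D.IsPathCycleGraph T) {x : W} (hx : x ∈ T) :
    ∃ y ∈ T, y ≠ x ∧ ∃ p : D.Walk x y, p.IsPath ∧ p.IsSpanning ∧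
      ∀ w ∈ T, w ∈ p.support → w = x ∨ w = y := by
  obtain ⟨y, p, hp, hmax⟩ := Walk.IsPath.exists_longest D x
  obtain ⟨a, ha⟩ := h.one x hx
  have hxa : D.Adj x a := (ha a).2 rfl
  have hpos : 1 ≤ p.length := hmax a hxa.toWalk (by simp [hxa.ne])
  have hnil : ¬ p.Nil := by rw [Walk.not_nil_iff_lt_length]; omega
  have edge_iff : ∀ w u, s(w, u) ∈ p.edges ↔ u ∈ p.toSubgraph.neighborSet w := fun w u => by
    rw [Subgraph.mem_neighborSet, Walk.adj_toSubgraph_iff_mem_edges]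
  have hinner : ∀ i, i ≠ 0 → i < p.length → p.getVert i ∉ T ∧
      ∀ u, D.Adj (p.getVert i) u → s(p.getVert i, u) ∈ p.edges := by
    intro i h0 hi
    have hne : p.getVert (i - 1) ≠ p.getVert (i + 1) := fun he => by
      have := hp.getVert_injOn (by simp; omega) (by simp; omega) he
      omega
    have hs := hp.neighborSet_toSubgraph_internal h0 hi
    have h1 : D.Adj (p.getVert i) (p.getVert (i - 1)) :=
      p.adj_of_mem_edges ((edge_iff _ _).2 (by simp [hs]))
    have h2 : D.Adj (p.getVert i) (p.getVert (i + 1)) :=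
      p.adj_of_mem_edges ((edge_iff _ _).2 (by simp [hs]))
    have hT : p.getVert i ∉ T := fun hT => by
      obtain ⟨b, hb⟩ := h.one _ hT
      exact hne (((hb _).1 h1).trans ((hb _).1 h2).symm)
    refine ⟨hT, fun u hu => ?_⟩
    rw [edge_iff, hs]
    rcases h.two _ hT with hn | ⟨b, c, -, hbc⟩
    · exact absurd hu (hn u)
    · rw [hbc] at h1 h2 hu
      simp only [Set.mem_insert_iff, Set.mem_singleton_iff]
      grind
  have hstart : ∀ u, D.Adj x u → s(x, u) ∈ p.edges := fun u hu => by
    have hs := hp.neighborSet_toSubgraph_startpoint hnil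
    have h1 := (ha _).1 (p.adj_snd hnil)
    rw [edge_iff, hs, h1]
    exact (ha u).1 hu
  have hend : ∀ u, D.Adj y u → s(y, u) ∈ p.edges := fun u hu => by
    have hus : u ∈ p.support := by
      by_contra hus
      have := hmax u (p.concat hu) (hp.concat hus hu)
      simp at this
    obtain ⟨i, rfl, hi⟩ := Walk.mem_support_iff_exists_getVert.1 hus
    rw [Sym2.eq_swap]
    rcases Nat.eq_zero_or_pos i with rfl | h0
    · simpa using hstart y (by simpa using hu.symm)
    · rcases hi.lt_or_eq with hi | rfl
      · exact (hinner i h0.ne' hi).2 y hu.symm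
      · simp at hu
  have hyT : y ∈ T := by
    by_contra hy
    have hs := hp.neighborSet_toSubgraph_endpoint hnil
    have hadj : ∀ u, D.Adj y u → u = p.penultimate := fun u hu => by
      simpa [hs] using (edge_iff _ _).1 (hend u hu)
    rcases h.two y hy with hn | ⟨b, c, hne, hbc⟩
    · exact hn _ (p.adj_penultimate hnil).symm
    · exact hne ((hadj b ((hbc b).2 (.inl rfl))).trans (hadj c ((hbc c).2 (.inr rfl))).symm)
  refine ⟨y, hyT, ?_, p, hp, ?_, ?_⟩
  · rintro rfl
    exact hnil (Walk.isPath_iff_nil.1 hp)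
  · intro w hw
    obtain ⟨i, rfl, hi⟩ := Walk.mem_support_iff_exists_getVert.1 hw
    rcases Nat.eq_zero_or_pos i with rfl | h0
    · simpa using hstart
    · rcases hi.lt_or_eq with hi | rfl
      · exact (hinner i h0.ne' hi).2
      · simpa using hend
  · intro w hwT hw
    obtain ⟨i, rfl, hi⟩ := Walk.mem_support_iff_exists_getVert.1 hw
    rcases Nat.eq_zero_or_pos i with rfl | h0
    · simp
    · rcases hi.lt_or_eq with hi | rfl
      · exact absurd hwT (hinner i h0.ne' hi).1
      · simp

theorem deleteEdge (h : D.IsPathCycleGraph T) {x a : W} (hx : x ∉ T) (ha : a ∉ T)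
    (hxa : D.Adj x a) : (D.deleteEdges {s(x, a)}).IsPathCycleGraph (T ∪ {x, a}) := by
  have key : ∀ v w, v ∉ T → D.Adj v w → ∃ y, y ≠ w ∧ ∀ u, D.Adj v u ↔ u = w ∨ u = y := by
    intro v w hv hvw
    rcases h.two v hv with hn | ⟨b, c, hne, hbc⟩
    · exact absurd hvw (hn w)
    · rcases (hbc w).1 hvw with rfl | rfl
      · exact ⟨c, hne.symm, hbc⟩
      · exact ⟨b, hne, fun u => (hbc u).trans or_comm⟩
  have hne := hxa.ne
  constructor
  · rintro v (hv | rfl | rfl)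
    · obtain ⟨y, hy⟩ := h.one v hv
      have h1 : v ≠ x := fun e => hx (e ▸ hv)
      have h2 : v ≠ a := fun e => ha (e ▸ hv)
      exact ⟨y, fun w => by simp [hy, h1, h2]⟩
    · obtain ⟨y, hy, hb⟩ := key v a hx hxa
      exact ⟨y, fun w => by
        simp only [deleteEdges_adj, hb, Set.mem_singleton_iff, Sym2.eq_iff]
        grind⟩
    · obtain ⟨y, hy, hb⟩ := key v x ha hxa.symm
      exact ⟨y, fun w => by
        simp only [deleteEdges_adj, hb, Set.mem_singleton_iff, Sym2.eq_iff]
        grind⟩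
  · intro v hv
    simp only [Set.mem_union, Set.mem_insert_iff, Set.mem_singleton_iff, not_or] at hv
    have : ∀ w, (D.deleteEdges {s(x, a)}).Adj v w ↔ D.Adj v w := fun w => by simp [hv]
    simpa only [this] using h.two v hv.1

theorem exists_cycle [Finite W] (h : D.IsPathCycleGraph T) {x a : W} (hxa : D.Adj x a)
    (hT : ∀ t ∈ T, ¬ D.Reachable x t) :
    ∃ c : D.Walk x x, c.IsCycle ∧ c.IsSpanning := by
  have hx : x ∉ T := fun hx => hT x hx (Reachable.refl x)
  have ha : a ∉ T := fun ha => hT a ha hxa.reachable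
  have hle : D.deleteEdges {s(x, a)} ≤ D := deleteEdges_le _
  obtain ⟨y, hyT, hyne, p, hp, hsp, -⟩ := (h.deleteEdge hx ha hxa).exists_path (x := a) (by simp)
  have hyx : y = x := by
    rcases hyT with hy | rfl | rfl
    · exact absurd (hxa.reachable.trans (p.reachable.mono hle)) (hT y hy)
    · rfl
    · exact absurd rfl hyne
  subst hyx
  refine ⟨Walk.cons hxa (p.mapLe hle), ?_, ?_⟩
  · rw [Walk.cons_isCycle_iff]
    refine ⟨hp.mapLe hle, fun hmem => ?_⟩
    rw [Walk.edges_mapLe_eq_edges] at hmem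
    simpa using p.adj_of_mem_edges hmem
  · intro w hw u hu
    rw [Walk.support_cons, Walk.support_mapLe_eq_support, List.mem_cons] at hw
    rw [Walk.edges_cons, Walk.edges_mapLe_eq_edges, List.mem_cons]
    have hw' : w ∈ p.support := hw.elim (fun e => e ▸ p.end_mem_support) id
    by_cases he : s(w, u) = s(y, a)
    · exact .inl he
    · exact .inr (hsp w hw' u (by simpa [deleteEdges_adj, hu] using he))

theorem card_image_connectedComponentMk [Finite W] [DecidableEq D.ConnectedComponent]
    {T : Finset W} (h : D.IsPathCycleGraph T) :
    (T.image D.connectedComponentMk).card = T.card / 2 := by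
  classical
  have hsum := Finset.card_eq_sum_card_image D.connectedComponentMk T
  rw [Finset.sum_const_nat (m := 2)] at hsum
  · omega
  · intro c hc
    obtain ⟨x, hx, rfl⟩ := Finset.mem_image.1 hc
    obtain ⟨y, hy, hyx, p, -, hsp, hT⟩ := h.exists_path hx
    rw [Finset.card_eq_two]
    refine ⟨x, y, hyx.symm, ?_⟩
    ext w
    simp only [Finset.mem_filter, ConnectedComponent.eq, Finset.mem_insert, Finset.mem_singleton]
    constructor
    · rintro ⟨hw, hr⟩
      exact hT w hw (hsp.mem_support_iff.2 hr.symm)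
    · rintro (rfl | rfl)
      · exact ⟨hx, Reachable.refl _⟩
      · exact ⟨hy, p.reachable.symm⟩

theorem exists_pathFamily [Finite W] {T : Finset W} (h : D.IsPathCycleGraph T) :
    ∃ f : Fin (T.card / 2) → (u : W) × (v : W) × D.Walk u v,
      (∀ i, (f i).2.2.IsPath ∧ (f i).2.2.IsSpanning) ∧
      (∀ i, (f i).1 ∈ T ∧ (f i).2.1 ∈ T ∧ (f i).1 ≠ (f i).2.1) ∧
      (∀ i j, D.Reachable (f i).1 (f j).1 → i = j) ∧
      ∀ t ∈ T, ∃ i, t = (f i).1 ∨ t = (f i).2.1 := by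
  classical
  let e := (T.image D.connectedComponentMk).equivFinOfCardEq h.card_image_connectedComponentMk
  have hrep : ∀ i, ∃ x ∈ T, D.connectedComponentMk x = (e.symm i).1 := fun i =>
    Finset.mem_image.1 (e.symm i).2
  choose x hxT hx using hrep
  choose y hyT hyx p hp hsp hT using fun i => h.exists_path (hxT i)
  refine ⟨fun i => ⟨x i, y i, p i⟩, fun i => ⟨hp i, hsp i⟩,
    fun i => ⟨hxT i, hyT i, (hyx i).symm⟩, fun i j hr => ?_, fun t ht => ?_⟩
  · have := ConnectedComponent.eq.2 hr
    exact e.symm.injective (Subtype.ext ((hx i).symm.trans (this.trans (hx j))))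
  · refine ⟨e ⟨_, Finset.mem_image_of_mem _ ht⟩, hT _ t ht ?_⟩
    rw [(hsp _).mem_support_iff, ← ConnectedComponent.eq, hx, Equiv.symm_apply_apply]

theorem exists_cycleFamily [Finite W] (h : D.IsPathCycleGraph T) :
    ∃ (m : ℕ) (g : Fin m → (x : W) × D.Walk x x),
      (∀ j, (g j).2.IsCycle ∧ (g j).2.IsSpanning ∧ ∀ t ∈ T, ¬ D.Reachable (g j).1 t) ∧
      (∀ j j', D.Reachable (g j).1 (g j').1 → j = j') ∧
      ∀ x a, D.Adj x a → (∀ t ∈ T, ¬ D.Reachable x t) → ∃ j, D.Reachable (g j).1 x := by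
  let C := {c : D.ConnectedComponent //
    ∃ x a, D.connectedComponentMk x = c ∧ D.Adj x a ∧ ∀ t ∈ T, ¬ D.Reachable x t}
  let e : C ≃ Fin (Nat.card C) := Finite.equivFin C
  choose x a hx hxa hT using fun j => (e.symm j).2
  choose c hc hsp using fun j => h.exists_cycle (hxa j) (hT j)
  refine ⟨Nat.card C, fun j => ⟨x j, c j⟩, fun j => ⟨hc j, hsp j, hT j⟩, fun j j' hr => ?_,
    fun y b hyb hy => ⟨e ⟨_, y, b, rfl, hyb, hy⟩, ?_⟩⟩
  · have := ConnectedComponent.eq.2 hr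
    exact e.symm.injective (Subtype.ext ((hx j).symm.trans (this.trans (hx j'))))
  · rw [← ConnectedComponent.eq, hx, Equiv.symm_apply_apply]

end IsPathCycleGraph

end SimpleGraph

/-- `n v i` is the neighbour of `v` along the edge carrying index `i` at `v`. -/
def IsPortEnum {V : Type} (G : SimpleGraph V) (idx : V → Sym2 V → Fin 3)
    (n : V → Fin 3 → V) : Prop :=
  ∀ v i w, (G.Adj v w ∧ idx v s(v, w) = i) ↔ w = n v i

theorem exists_isPortEnum {V : Type} (G : SimpleGraph V) (idx : V → Sym2 V → Fin 3)
    (hcubic : ∀ v : V, (G.neighborSet v).ncard = 3)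
    (hidx : ∀ v : V, Set.InjOn (idx v) (G.incidenceSet v)) :
    ∃ n, IsPortEnum G idx n := by
  have hinj : ∀ v, Set.InjOn (fun w => idx v s(v, w)) (G.neighborSet v) := by
    intro v a ha b hb hab
    exact Sym2.congr_right.1 (hidx v ((G.mem_incidenceSet v a).2 ha)
      ((G.mem_incidenceSet v b).2 hb) hab)
  have hsurj : ∀ v i, ∃ w, G.Adj v w ∧ idx v s(v, w) = i := by
    intro v i
    have himg : (fun w => idx v s(v, w)) '' G.neighborSet v = Set.univ := by
      apply Set.eq_of_subset_of_ncard_le (Set.subset_univ _)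
      rw [(hinj v).ncard_image, hcubic, Set.ncard_univ, Nat.card_fin]
    exact himg.ge (Set.mem_univ i)
  choose n hn hni using hsurj
  refine ⟨n, fun v i w => ⟨fun ⟨hw, hi⟩ => hinj v hw (hn v i) (hi.trans (hni v i).symm), ?_⟩⟩
  rintro rfl
  exact ⟨hn v i, hni v i⟩

section Gadget

variable {V : Type} {G : SimpleGraph V} {idx : V → Sym2 V → Fin 3} {n : V → Fin 3 → V}
  {Z X Y : Finset V} {M N : Finset (Sym2 (HVert V))}

theorem extEdge_mk (u w : V) : extEdge idx s(u, w) = s(fEnd idx u w, fEnd idx w u) := rfl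

namespace IsPortEnum

theorem adj (hn : IsPortEnum G idx n) (v : V) (i : Fin 3) : G.Adj v (n v i) :=
  ((hn v i _).2 rfl).1

theorem idx_eq (hn : IsPortEnum G idx n) (v : V) (i : Fin 3) : idx v s(v, n v i) = i :=
  ((hn v i _).2 rfl).2

theorem injective (hn : IsPortEnum G idx n) (v : V) : Function.Injective (n v) := by
  intro i j hij
  rw [← hn.idx_eq v i, hij, hn.idx_eq]

theorem eq_of_adj (hn : IsPortEnum G idx n) {v w : V} (h : G.Adj v w) :
    w = n v (idx v s(v, w)) :=
  (hn v _ w).1 ⟨h, rfl⟩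

theorem extEdge_eq (hn : IsPortEnum G idx n) (v : V) (i : Fin 3) :
    extEdge idx s(v, n v i) = s(.inl (v, i), fEnd idx (n v i) v) := by
  rw [extEdge_mk, fEnd, hn.idx_eq]

theorem gadgetGraph_adj_inl (hn : IsPortEnum G idx n) (v : V) (i : Fin 3) (y : HVert V) :
    (gadgetGraph G idx Z).Adj (.inl (v, i)) y ↔
      y = fEnd idx (n v i) v ∨ (v ∉ Z ∧ ∃ j, j ≠ i ∧ y = .inl (v, j)) ∨
        (v ∈ Z ∧ y = .inr v) := by
  have hne := (hn.adj v i).ne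
  rcases y with ⟨w, j⟩ | w
  · simp only [gadgetGraph, SimpleGraph.fromRel_adj, hRel, fEnd, Sum.inl.injEq, Prod.mk.injEq,
      reduceCtorEq, and_false, or_false, ne_eq]
    have h1 := hn v i w
    have hs : s(w, v) = s(v, w) := Sym2.eq_swap
    rw [hs, G.adj_comm w v]
    have hs' : s(n v i, v) = s(v, n v i) := Sym2.eq_swap
    have hex : (∃ k, ¬k = i ∧ w = v ∧ j = k) ↔ w = v ∧ j ≠ i := by
      constructor
      · rintro ⟨k, hk, rfl, rfl⟩
        exact ⟨rfl, hk⟩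
      · rintro ⟨rfl, hj⟩
        exact ⟨j, hj, rfl, rfl⟩
    rw [hs', hex]
    grind
  · simp only [gadgetGraph, SimpleGraph.fromRel_adj, hRel, fEnd, reduceCtorEq, and_false,
      exists_const, Sum.inr.injEq, ne_eq, not_false_eq_true, true_and, false_or]
    grind

end IsPortEnum

theorem gadgetGraph_adj_inr (z : V) (y : HVert V) :
    (gadgetGraph G idx Z).Adj (.inr z) y ↔ z ∈ Z ∧ ∃ i, y = .inl (z, i) := by
  rcases y with ⟨w, j⟩ | w
  · simp [gadgetGraph, SimpleGraph.fromRel_adj, hRel]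
    grind
  · simp [gadgetGraph, SimpleGraph.fromRel_adj, hRel]

@[simp] theorem inl_mem_gadgetVerts (x : V × Fin 3) : (Sum.inl x : HVert V) ∈ gadgetVerts X :=
  trivial

@[simp] theorem inr_mem_gadgetVerts (z : V) : (Sum.inr z : HVert V) ∈ gadgetVerts X ↔ z ∈ X :=
  Iff.rfl

namespace IsPMgadget

theorem adj (hM : IsPMgadget G idx Z X M) {x y : HVert V} (h : s(x, y) ∈ M) :
    (gadgetGraph G idx Z).Adj x y :=
  (hM.1 _ h).1

theorem mem_verts (hM : IsPMgadget G idx Z X M) {x y : HVert V} (h : s(x, y) ∈ M) :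
    x ∈ gadgetVerts X :=
  (hM.1 _ h).2 x (by simp)

theorem exists_partner (hM : IsPMgadget G idx Z X M) {x : HVert V} (hx : x ∈ gadgetVerts X) :
    ∃ y, ∀ w, s(x, w) ∈ M ↔ w = y := by
  obtain ⟨e, ⟨he, hxe⟩, huniq⟩ := hM.2 x hx
  obtain ⟨y, rfl⟩ := Sym2.mem_iff_exists.1 hxe
  refine ⟨y, fun w => ⟨fun hw => ?_, fun hw => hw ▸ he⟩⟩
  exact Sym2.congr_right.1 (huniq _ ⟨hw, by simp⟩)

theorem partner_unique (hM : IsPMgadget G idx Z X M) {x y w : HVert V} (hy : s(x, y) ∈ M)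
    (hw : s(x, w) ∈ M) : y = w := by
  obtain ⟨a, ha⟩ := hM.exists_partner (hM.mem_verts hy)
  rw [(ha y).1 hy, (ha w).1 hw]

theorem exists_perm_of_notMem (hn : IsPortEnum G idx n) (hM : IsPMgadget G idx Z X M) {v : V}
    (hv : v ∉ Z) :
    ∃ σ : Fin 3 → Fin 3, (∀ i, σ (σ i) = i) ∧
      (∀ i, extEdge idx s(v, n v i) ∈ M ↔ σ i = i) ∧
      ∀ i j, i ≠ j → (s((.inl (v, i) : HVert V), .inl (v, j)) ∈ M ↔ σ i = j) := by
  have hex : ∀ i, ∃ k, (k = i ∧ s((.inl (v, i) : HVert V), fEnd idx (n v i) v) ∈ M) ∨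
      (k ≠ i ∧ s((.inl (v, i) : HVert V), .inl (v, k)) ∈ M) := by
    intro i
    obtain ⟨y, hy⟩ := hM.exists_partner (inl_mem_gadgetVerts (v, i))
    have hyM := (hy y).2 rfl
    rcases (hn.gadgetGraph_adj_inl v i y).1 (hM.adj hyM) with rfl | ⟨-, j, hj, rfl⟩ | ⟨h, -⟩
    · exact ⟨i, .inl ⟨rfl, hyM⟩⟩
    · exact ⟨j, .inr ⟨hj, hyM⟩⟩
    · exact absurd h hv
  choose σ hσ using hex
  have hne : ∀ i j, fEnd idx (n v i) v ≠ .inl (v, j) := fun i j he => by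
    simp only [fEnd, Sum.inl.injEq, Prod.mk.injEq] at he
    exact (hn.adj v i).ne he.1.symm
  have hinner : ∀ i j, i ≠ j → (s((.inl (v, i) : HVert V), .inl (v, j)) ∈ M ↔ σ i = j) := by
    intro i j hij
    constructor
    · intro hm
      rcases hσ i with ⟨-, hk⟩ | ⟨-, hk⟩
      · exact absurd (hM.partner_unique hk hm) (hne i j)
      · simpa using hM.partner_unique hk hm
    · rintro rfl
      exact ((hσ i).resolve_left fun h => hij h.1.symm).2
  refine ⟨σ, fun i => ?_, fun i => ?_, hinner⟩
  · by_cases hi : σ i = i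
    · rw [hi, hi]
    · have := (hinner i (σ i) (Ne.symm hi)).2 rfl
      rw [Sym2.eq_swap] at this
      exact (hinner _ _ hi).1 this
  · rw [hn.extEdge_eq]
    constructor
    · intro hm
      rcases hσ i with ⟨h, -⟩ | ⟨-, hk⟩
      · exact h
      · exact absurd (hM.partner_unique hm hk) (hne i _)
    · intro h
      exact ((hσ i).resolve_right fun h' => h'.1 h).2

theorem extEdge_mem_iff (hn : IsPortEnum G idx n) (hM : IsPMgadget G idx Z X M) {z : V}
    (hz : z ∈ Z) (i : Fin 3) :
    extEdge idx s(z, n z i) ∈ M ↔ s((.inr z : HVert V), .inl (z, i)) ∉ M := by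
  rw [hn.extEdge_eq, Sym2.eq_swap (a := Sum.inr z)]
  obtain ⟨y, hy⟩ := hM.exists_partner (inl_mem_gadgetVerts (z, i))
  have hyM := (hy y).2 rfl
  rw [hy, hy]
  rcases (hn.gadgetGraph_adj_inl z i y).1 (hM.adj hyM) with rfl | ⟨h, -⟩ | ⟨-, rfl⟩
  · simp [fEnd]
  · exact absurd hz h
  · simp [fEnd]

theorem exists_center_partner (hM : IsPMgadget G idx Z X M) {z : V} (hz : z ∈ X) :
    ∃ i, ∀ y, s((.inr z : HVert V), y) ∈ M ↔ y = .inl (z, i) := by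
  obtain ⟨y, hy⟩ := hM.exists_partner ((inr_mem_gadgetVerts z).2 hz)
  obtain ⟨-, i, rfl⟩ := (gadgetGraph_adj_inr z y).1 (hM.adj ((hy y).2 rfl))
  exact ⟨i, hy⟩

theorem center_notMem (hM : IsPMgadget G idx Z X M) {z : V} (hz : z ∉ X) (y : HVert V) :
    s((.inr z : HVert V), y) ∉ M :=
  fun h => hz ((inr_mem_gadgetVerts z).1 (hM.mem_verts h))

end IsPMgadget

/-- The subgraph of `G` formed by the edges whose external edge lies in `E`. -/
def usedGraph (G : SimpleGraph V) (idx : V → Sym2 V → Fin 3) (E : Finset (Sym2 (HVert V))) :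
    SimpleGraph V where
  Adj u w := G.Adj u w ∧ extEdge idx s(u, w) ∈ E
  symm := ⟨fun u w h => ⟨h.1.symm, by rw [Sym2.eq_swap]; exact h.2⟩⟩
  loopless := ⟨fun u h => h.1.ne rfl⟩

theorem usedGraph_le (E : Finset (Sym2 (HVert V))) : usedGraph G idx E ≤ G :=
  fun _ _ h => h.1

theorem mem_edgeSet_usedGraph {E : Finset (Sym2 (HVert V))} {e : Sym2 V} :
    e ∈ (usedGraph G idx E).edgeSet ↔ e ∈ G.edgeSet ∧ extEdge idx e ∈ E := by
  induction e using Sym2.ind with | _ a b => rfl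

theorem IsPortEnum.usedGraph_adj (hn : IsPortEnum G idx n) {E : Finset (Sym2 (HVert V))}
    {v w : V} :
    (usedGraph G idx E).Adj v w ↔ ∃ i, w = n v i ∧ extEdge idx s(v, n v i) ∈ E := by
  constructor
  · rintro ⟨h, he⟩
    refine ⟨_, hn.eq_of_adj h, ?_⟩
    rwa [← hn.eq_of_adj h]
  · rintro ⟨i, rfl, he⟩
    exact ⟨hn.adj v i, he⟩

end Gadget

section SymmDiff

theorem exists_pair_fixed_iff_ne {σ τ : Fin 3 → Fin 3} (hσ : ∀ i, σ (σ i) = i)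
    (hτ : ∀ i, τ (τ i) = i) :
    (∀ k, σ k = k ↔ τ k = k) ∨
      ∃ i j, i ≠ j ∧ ∀ k, ¬(σ k = k ↔ τ k = k) ↔ k = i ∨ k = j := by
  revert σ τ
  decide +kernel

theorem exists_link_of_ne {σ τ : Fin 3 → Fin 3} (hσ : ∀ i, σ (σ i) = i)
    (hτ : ∀ i, τ (τ i) = i) {i j : Fin 3} (hi : σ i ≠ τ i) (hj : σ j ≠ τ j) (hij : i ≠ j) :
    ¬(σ i = j ↔ τ i = j) ∨
      ∃ k, i ≠ k ∧ k ≠ j ∧ ¬(σ i = k ↔ τ i = k) ∧ ¬(σ k = j ↔ τ k = j) := by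
  revert σ τ i j
  decide +kernel

variable {V : Type} [DecidableEq V] {G : SimpleGraph V} {idx : V → Sym2 V → Fin 3}
  {n : V → Fin 3 → V} {Z X Y : Finset V} {M N : Finset (Sym2 (HVert V))}

/-- The graph on the gadget vertices with edge set `M ∆ N`. -/
abbrev deltaGraph (M N : Finset (Sym2 (HVert V))) : SimpleGraph (HVert V) :=
  SimpleGraph.fromEdgeSet (↑(symmDiff M N) : Set (Sym2 (HVert V)))

/-- The vertex of `G` in whose gadget a vertex of `H` lies. -/
def gadgetBase : HVert V → V := Sum.elim Prod.fst id

theorem mem_symmDiff_iff_not_iff {e : Sym2 (HVert V)} :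
    e ∈ symmDiff M N ↔ ¬(e ∈ M ↔ e ∈ N) := by
  rw [Finset.mem_symmDiff]
  tauto

theorem deltaGraph_adj (hM : IsPMgadget G idx Z X M) (hN : IsPMgadget G idx Z Y N)
    {x y : HVert V} : (deltaGraph M N).Adj x y ↔ s(x, y) ∈ symmDiff M N := by
  rw [SimpleGraph.fromEdgeSet_adj, Finset.mem_coe, and_iff_left_iff_imp, Finset.mem_symmDiff]
  rintro (⟨h, -⟩ | ⟨h, -⟩)
  · exact (hM.adj h).ne
  · exact (hN.adj h).ne

theorem gadgetGraph_adj_of_deltaGraph_adj (hM : IsPMgadget G idx Z X M)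
    (hN : IsPMgadget G idx Z Y N) {x y : HVert V} (h : (deltaGraph M N).Adj x y) :
    (gadgetGraph G idx Z).Adj x y := by
  rw [deltaGraph_adj hM hN, Finset.mem_symmDiff] at h
  exact h.elim (fun h => hM.adj h.1) (fun h => hN.adj h.1)

theorem notMem_symmDiff_of_common_partner (hM : IsPMgadget G idx Z X M)
    (hN : IsPMgadget G idx Z Y N) {x c : HVert V} (hcM : s(x, c) ∈ M) (hcN : s(x, c) ∈ N)
    (a : HVert V) : s(x, a) ∉ symmDiff M N := by
  rw [Finset.mem_symmDiff]
  rintro (⟨h, h'⟩ | ⟨h, h'⟩)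
  · exact h' (hM.partner_unique hcM h ▸ hcN)
  · exact h' (hN.partner_unique hcN h ▸ hcM)

theorem exists_symmDiff_terminal (hn : IsPortEnum G idx n) (hM : IsPMgadget G idx Z X M)
    (hN : IsPMgadget G idx Z (Z \ X) N) {z : V} (hz : z ∈ Z) :
    ∃ i, (∀ y, s((.inr z : HVert V), y) ∈ symmDiff M N ↔ y = .inl (z, i)) ∧
      ∀ j, extEdge idx s(z, n z j) ∈ symmDiff M N ↔ j = i := by
  have aux : ∀ {X Y : Finset V} {M N : Finset (Sym2 (HVert V))}, IsPMgadget G idx Z X M →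
      IsPMgadget G idx Z Y N → z ∈ X → z ∉ Y →
      ∃ i, (∀ y, s((.inr z : HVert V), y) ∈ symmDiff M N ↔ y = .inl (z, i)) ∧
        ∀ j, extEdge idx s(z, n z j) ∈ symmDiff M N ↔ j = i := by
    intro X Y M N hM hN hX hY
    obtain ⟨i, hi⟩ := hM.exists_center_partner hX
    refine ⟨i, fun y => ?_, fun j => ?_⟩
    · simp [Finset.mem_symmDiff, hi, hN.center_notMem hY]
    · simp [Finset.mem_symmDiff, hM.extEdge_mem_iff hn hz, hN.extEdge_mem_iff hn hz, hi,
        hN.center_notMem hY]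
  by_cases hX : z ∈ X
  · exact aux hM hN hX (by simp [hX])
  · rw [symmDiff_comm]
    exact aux hN hM (by simp [hX, hz]) hX

theorem deltaGraph_isPathCycleGraph (hn : IsPortEnum G idx n) (hM : IsPMgadget G idx Z X M)
    (hN : IsPMgadget G idx Z (Z \ X) N) :
    (deltaGraph M N).IsPathCycleGraph (Sum.inr '' (Z : Set V)) := by
  constructor
  · rintro _ ⟨z, hz, rfl⟩
    obtain ⟨i, hi, -⟩ := exists_symmDiff_terminal hn hM hN hz
    exact ⟨_, fun w => by rw [deltaGraph_adj hM hN, hi]⟩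
  · rintro (x | z) hx
    · obtain ⟨a, ha⟩ := hM.exists_partner (inl_mem_gadgetVerts x)
      obtain ⟨b, hb⟩ := hN.exists_partner (inl_mem_gadgetVerts x)
      simp only [deltaGraph_adj hM hN, mem_symmDiff_iff_not_iff, ha, hb]
      by_cases hab : a = b
      · simp [hab]
      · exact .inr ⟨a, b, hab, fun w => by grind⟩
    · left
      intro w h
      have := gadgetGraph_adj_of_deltaGraph_adj hM hN h
      rw [gadgetGraph_adj_inr] at this
      exact hx ⟨z, this.1, rfl⟩

theorem usedGraph_isPathCycleGraph (hn : IsPortEnum G idx n) (hM : IsPMgadget G idx Z X M)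
    (hN : IsPMgadget G idx Z (Z \ X) N) :
    (usedGraph G idx (symmDiff M N)).IsPathCycleGraph (Z : Set V) := by
  constructor
  · intro z hz
    obtain ⟨i, -, hi⟩ := exists_symmDiff_terminal hn hM hN hz
    exact ⟨n z i, fun w => by simp [hn.usedGraph_adj, hi]⟩
  · intro v hv
    obtain ⟨σ, hσ, hσe, -⟩ := hM.exists_perm_of_notMem hn hv
    obtain ⟨τ, hτ, hτe, -⟩ := hN.exists_perm_of_notMem hn hv
    simp only [hn.usedGraph_adj, mem_symmDiff_iff_not_iff, hσe, hτe]
    rcases exists_pair_fixed_iff_ne hσ hτ with h | ⟨i, j, hij, h⟩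
    · left
      rintro w ⟨k, -, hk⟩
      exact hk (h k)
    · refine .inr ⟨n v i, n v j, (hn.injective v).ne hij, fun w => ?_⟩
      simp only [h]
      grind

theorem reachable_of_gadgetBase_eq (hn : IsPortEnum G idx n) (hM : IsPMgadget G idx Z X M)
    (hN : IsPMgadget G idx Z (Z \ X) N) {x y a b : HVert V} (hx : (deltaGraph M N).Adj x a)
    (hy : (deltaGraph M N).Adj y b) (hxy : gadgetBase x = gadgetBase y) :
    (deltaGraph M N).Reachable x y := by
  obtain ⟨v, hv⟩ : ∃ v, gadgetBase x = v := ⟨_, rfl⟩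
  rw [hv] at hxy
  by_cases hvZ : v ∈ Z
  · have key : ∀ {x a : HVert V}, (deltaGraph M N).Adj x a → gadgetBase x = v →
        (deltaGraph M N).Reachable (.inr v) x := by
      rintro (⟨w, j⟩ | w) a h rfl
      · obtain ⟨i, hi, hj⟩ := exists_symmDiff_terminal hn hM hN hvZ
        by_cases hji : j = i
        · exact SimpleGraph.Adj.reachable
            ((deltaGraph_adj hM hN).2 ((hi _).2 (by simp [gadgetBase, hji])))
        · exfalso
          have h1 := mt (hj j).1 hji
          have h2 := mt (hi (.inl (w, j))).1 (by simp [gadgetBase, hji])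
          simp only [gadgetBase, Sum.elim_inl] at h1 h2 hvZ
          rw [mem_symmDiff_iff_not_iff, not_not] at h1 h2
          rw [deltaGraph_adj hM hN] at h
          by_cases hc : s((.inr w : HVert V), .inl (w, j)) ∈ M
          · have hc' := h2.1 hc
            rw [Sym2.eq_swap] at hc hc'
            exact notMem_symmDiff_of_common_partner hM hN hc hc' a h
          · have hc' := (hM.extEdge_mem_iff hn hvZ j).2 hc
            have hc'' := h1.1 hc'
            rw [hn.extEdge_eq] at hc' hc''
            exact notMem_symmDiff_of_common_partner hM hN hc' hc'' a h
      · exact SimpleGraph.Reachable.refl _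
    exact (key hx hv).symm.trans (key hy hxy.symm)
  · have key : ∀ {x a : HVert V}, (deltaGraph M N).Adj x a → gadgetBase x = v →
        ∃ i, x = .inl (v, i) := by
      rintro (⟨w, j⟩ | w) a h rfl
      · exact ⟨j, rfl⟩
      · have := gadgetGraph_adj_of_deltaGraph_adj hM hN h
        rw [gadgetGraph_adj_inr] at this
        exact absurd this.1 hvZ
    obtain ⟨i, rfl⟩ := key hx hv
    obtain ⟨j, rfl⟩ := key hy hxy.symm
    obtain ⟨σ, hσ, hσe, hσi⟩ := hM.exists_perm_of_notMem hn hvZ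
    obtain ⟨τ, hτ, hτe, hτi⟩ := hN.exists_perm_of_notMem hn hvZ
    have hne : ∀ {i a}, (deltaGraph M N).Adj (.inl (v, i)) a → σ i ≠ τ i := by
      intro i a h he
      rw [deltaGraph_adj hM hN] at h
      by_cases hi : σ i = i
      · have h1 := (hσe i).2 hi
        have h2 := (hτe i).2 (he ▸ hi)
        rw [hn.extEdge_eq] at h1 h2
        exact notMem_symmDiff_of_common_partner hM hN h1 h2 a h
      · exact notMem_symmDiff_of_common_partner hM hN ((hσi i _ (Ne.symm hi)).2 rfl)
          ((hτi i _ (Ne.symm hi)).2 he.symm) a h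
    have hadj : ∀ {i j}, i ≠ j → ¬(σ i = j ↔ τ i = j) →
        (deltaGraph M N).Reachable (.inl (v, i)) (.inl (v, j)) := fun {i j} hij h =>
      SimpleGraph.Adj.reachable (by
        rwa [deltaGraph_adj hM hN, mem_symmDiff_iff_not_iff, hσi _ _ hij, hτi _ _ hij])
    by_cases hij : i = j
    · exact hij ▸ SimpleGraph.Reachable.refl _
    · rcases exists_link_of_ne hσ hτ (hne hx) (hne hy) hij with h | ⟨k, hik, hkj, h1, h2⟩
      · exact hadj hij h
      · exact (hadj hik h1).trans (hadj hkj h2)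

theorem gadgetBase_eq_or_adj (hM : IsPMgadget G idx Z X M)
    (hN : IsPMgadget G idx Z Y N) {x y : HVert V} (h : (deltaGraph M N).Adj x y) :
    gadgetBase x = gadgetBase y ∨
      (usedGraph G idx (symmDiff M N)).Adj (gadgetBase x) (gadgetBase y) := by
  have hH := gadgetGraph_adj_of_deltaGraph_adj hM hN h
  rw [deltaGraph_adj hM hN] at h
  rcases x with ⟨u, i⟩ | z
  · rcases y with ⟨w, j⟩ | z
    · simp only [gadgetGraph, SimpleGraph.fromRel_adj, hRel] at hH
      rcases hH.2 with (⟨h1, -⟩ | ⟨h1, rfl, rfl⟩) | (⟨h1, -⟩ | ⟨h1, rfl, rfl⟩)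
      · exact .inl h1
      · refine .inr ⟨h1, ?_⟩
        rwa [gadgetBase, Sum.elim_inl, Sum.elim_inl, extEdge_mk, fEnd, fEnd,
          Sym2.eq_swap (a := w)]
      · exact .inl h1.symm
      · refine .inr ⟨h1.symm, ?_⟩
        rwa [gadgetBase, Sum.elim_inl, Sum.elim_inl, extEdge_mk, fEnd, fEnd,
          Sym2.eq_swap (a := u) (b := w)]
    · obtain ⟨-, i, h⟩ := (gadgetGraph_adj_inr z _).1 hH.symm
      simp only [Sum.inl.injEq] at h
      exact .inl (by simp [gadgetBase, h])
  · obtain ⟨-, i, rfl⟩ := (gadgetGraph_adj_inr z y).1 hH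
    exact .inl rfl

theorem reachable_gadgetBase (hM : IsPMgadget G idx Z X M) (hN : IsPMgadget G idx Z Y N)
    {x y : HVert V} (h : (deltaGraph M N).Reachable x y) :
    (usedGraph G idx (symmDiff M N)).Reachable (gadgetBase x) (gadgetBase y) := by
  obtain ⟨p⟩ := h
  induction p with
  | nil => exact SimpleGraph.Reachable.refl _
  | cons h _ ih =>
    rcases gadgetBase_eq_or_adj hM hN h with he | ha
    · rwa [he]
    · exact ha.reachable.trans ih

theorem reachable_of_gadgetBase_reachable (hn : IsPortEnum G idx n)
    (hM : IsPMgadget G idx Z X M) (hN : IsPMgadget G idx Z (Z \ X) N) {x y a b : HVert V}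
    (hx : (deltaGraph M N).Adj x a) (hy : (deltaGraph M N).Adj y b)
    (h : (usedGraph G idx (symmDiff M N)).Reachable (gadgetBase x) (gadgetBase y)) :
    (deltaGraph M N).Reachable x y := by
  obtain ⟨p⟩ := h
  suffices ∀ {u w : V} (p : (usedGraph G idx (symmDiff M N)).Walk u w) {x a : HVert V},
      (deltaGraph M N).Adj x a → gadgetBase x = u → gadgetBase y = w →
      (deltaGraph M N).Reachable x y from this p hx rfl rfl
  intro u w p
  induction p with
  | nil =>
    intro x a hx hu hw
    exact reachable_of_gadgetBase_eq hn hM hN hx hy (hu.trans hw.symm)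
  | @cons u v w h _ ih =>
    intro x a hx hu hw
    have hadj : (deltaGraph M N).Adj (fEnd idx u v) (fEnd idx v u) :=
      (deltaGraph_adj hM hN).2 h.2
    exact (reachable_of_gadgetBase_eq hn hM hN hx hadj hu).trans
      (hadj.reachable.trans (ih hadj.symm rfl hw))

theorem exists_deltaGraph_adj_inr (hn : IsPortEnum G idx n) (hM : IsPMgadget G idx Z X M)
    (hN : IsPMgadget G idx Z (Z \ X) N) {z : V} (hz : z ∈ Z) :
    ∃ a, (deltaGraph M N).Adj (.inr z) a := by
  obtain ⟨i, hi, -⟩ := exists_symmDiff_terminal hn hM hN hz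
  exact ⟨_, (deltaGraph_adj hM hN).2 ((hi _).2 rfl)⟩

theorem reachable_inr_iff (hn : IsPortEnum G idx n) (hM : IsPMgadget G idx Z X M)
    (hN : IsPMgadget G idx Z (Z \ X) N) {z : V} (hz : z ∈ Z) {x a : HVert V}
    (hx : (deltaGraph M N).Adj x a) :
    (deltaGraph M N).Reachable (.inr z) x ↔
      (usedGraph G idx (symmDiff M N)).Reachable z (gadgetBase x) := by
  obtain ⟨b, hb⟩ := exists_deltaGraph_adj_inr hn hM hN hz
  exact ⟨reachable_gadgetBase hM hN, reachable_of_gadgetBase_reachable hn hM hN hb hx⟩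

theorem exists_mem_extEdge_reachable_iff (hn : IsPortEnum G idx n)
    (hM : IsPMgadget G idx Z X M) (hN : IsPMgadget G idx Z (Z \ X) N) {z : V} (hz : z ∈ Z)
    {e : Sym2 V} (he : extEdge idx e ∈ symmDiff M N) :
    (∃ y ∈ extEdge idx e, (deltaGraph M N).Reachable (.inr z) y) ↔
      ∃ u ∈ e, (usedGraph G idx (symmDiff M N)).Reachable z u := by
  induction e using Sym2.ind with | _ u w =>
  have hadj : (deltaGraph M N).Adj (fEnd idx u w) (fEnd idx w u) := (deltaGraph_adj hM hN).2 he
  simp only [extEdge_mk, Sym2.mem_iff, exists_eq_or_imp, exists_eq_left,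
    reachable_inr_iff hn hM hN hz hadj, reachable_inr_iff hn hM hN hz hadj.symm]
  rfl

theorem compEdges_usedGraph (hn : IsPortEnum G idx n) (hM : IsPMgadget G idx Z X M)
    (hN : IsPMgadget G idx Z (Z \ X) N) {z : V} (hz : z ∈ Z) :
    compEdges (usedGraph G idx (symmDiff M N)) z =
      {e | e ∈ G.edgeSet ∧ extEdge idx e ∈ symmDiff M N ∧
        ∃ y ∈ extEdge idx e, (deltaGraph M N).Reachable (.inr z) y} := by
  ext e
  simp only [compEdges, mem_edgeSet_usedGraph, Set.mem_ofPred_eq, and_assoc]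
  refine and_congr_right fun _ => and_congr_right fun he => ?_
  rw [exists_mem_extEdge_reachable_iff hn hM hN hz he]

end SymmDiff

/-!
STATEMENT 5.  Let `X ⊆ Z`, `M₁` a perfect matching of `H(X)`, `M₂` a perfect matching
of `H(Z∖X)`.  Every connected component of the graph with edge set `M₁ Δ M₂`
containing an edge is a cycle avoiding all terminal centers or a simple path whose two
endpoints are terminal centers, and every center `h(z)`, `z ∈ Z`, is an endpoint of
exactly one such path.  Moreover: (i) the `G`-edges whose external edge lies on a
path-component form a union of `|Z|/2` pairwise vertex-disjoint simple paths of `G`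
whose endpoints are exactly the vertices of `Z` (the path arising from a `Δ`-path
joining `h(z)` and `h(z′)` having endpoints `z` and `z′`); (ii) the `G`-edges whose
external edge lies on a cycle-component form a union of pairwise vertex-disjoint
cycles of `G`, disjoint from the paths of (i); and (iii) if every path-component has
both endpoints in `A`-centers or both in `B`-centers, then the edge set of (i) is a
solution to Disjoint `A`,`B`-paths on `G`.
-/
theorem stmt5 {V : Type} [Fintype V] [DecidableEq V]
    (G : SimpleGraph V) (A B : Finset V) (ℓ : Sym2 V → ℕ)
    (idx : V → Sym2 V → Fin 3)
    (hdisj : Disjoint A B) (hA : Even A.card) (hB : Even B.card)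
    (hcubic : ∀ v : V, (G.neighborSet v).ncard = 3)
    (hidx : ∀ v : V, Set.InjOn (idx v) (G.incidenceSet v))
    (hℓ : ∀ e ∈ G.edgeSet, 1 ≤ ℓ e)
    (X : Finset V) (hX : X ⊆ A ∪ B)
    (M₁ M₂ : Finset (Sym2 (HVert V)))
    (hM₁ : IsPMgadget G idx (A ∪ B) X M₁)
    (hM₂ : IsPMgadget G idx (A ∪ B) ((A ∪ B) \ X) M₂)
    (D : SimpleGraph (HVert V))
    (hD : D = SimpleGraph.fromEdgeSet (↑(symmDiff M₁ M₂) : Set (Sym2 (HVert V))))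
    (PE CE : Set (Sym2 V))
    (hPE : PE = {e | e ∈ G.edgeSet ∧ extEdge idx e ∈ symmDiff M₁ M₂ ∧
        ∃ z ∈ A ∪ B, ∃ y ∈ extEdge idx e, D.Reachable (Sum.inr z) y})
    (hCE : CE = {e | e ∈ G.edgeSet ∧ extEdge idx e ∈ symmDiff M₁ M₂ ∧
        ∀ z ∈ A ∪ B, ∀ y ∈ extEdge idx e, ¬ D.Reachable (Sum.inr z) y}) :
    -- every component with an edge is a cycle avoiding the centers or a path
    -- between two distinct centers
    (∀ ε ∈ symmDiff M₁ M₂,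
      (∃ (x : HVert V) (c : D.Walk x x), c.IsCycle ∧ ε ∈ c.edges ∧
          {ε' | ε' ∈ c.edges} = compEdges D x ∧
          ∀ z ∈ A ∪ B, (Sum.inr z : HVert V) ∉ c.support) ∨
      (∃ z z' : V, z ∈ A ∪ B ∧ z' ∈ A ∪ B ∧ z ≠ z' ∧
        ∃ p : D.Walk (Sum.inr z) (Sum.inr z'), p.IsPath ∧ ε ∈ p.edges ∧
          {ε' | ε' ∈ p.edges} = compEdges D (Sum.inr z))) ∧
    -- every center is an endpoint of exactly one such path
    (∀ z ∈ A ∪ B, ∃! z' : V, z' ∈ A ∪ B ∧ z' ≠ z ∧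
      ∃ p : D.Walk (Sum.inr z) (Sum.inr z'), p.IsPath ∧
        {ε' | ε' ∈ p.edges} = compEdges D (Sum.inr z)) ∧
    -- (i) and (ii)
    (∃ (f : Fin ((A ∪ B).card / 2) → (u : V) × (v : V) × G.Walk u v)
       (m : ℕ) (g : Fin m → (x : V) × G.Walk x x),
      (∀ i, (f i).2.2.IsPath) ∧
      (∀ i, (f i).1 ∈ A ∪ B ∧ (f i).2.1 ∈ A ∪ B ∧ (f i).1 ≠ (f i).2.1 ∧
        D.Reachable (Sum.inr (f i).1) (Sum.inr (f i).2.1)) ∧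
      (∀ i, {e | e ∈ (f i).2.2.edges} =
        {e | e ∈ G.edgeSet ∧ extEdge idx e ∈ symmDiff M₁ M₂ ∧
          ∃ y ∈ extEdge idx e, D.Reachable (Sum.inr (f i).1) y}) ∧
      (∀ i j, i ≠ j → ∀ x, x ∈ (f i).2.2.support → x ∉ (f j).2.2.support) ∧
      (∀ z ∈ A ∪ B, ∃ i, z = (f i).1 ∨ z = (f i).2.1) ∧
      (⋃ i, {e | e ∈ (f i).2.2.edges}) = PE ∧
      (∀ j, (g j).2.IsCycle) ∧
      (∀ j j', j ≠ j' → ∀ x, x ∈ (g j).2.support → x ∉ (g j').2.support) ∧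
      (∀ i j, ∀ x, x ∈ (f i).2.2.support → x ∉ (g j).2.support) ∧
      (⋃ j, {e | e ∈ (g j).2.edges}) = CE) ∧
    -- (iii)
    ((∀ z z' : V, z ∈ A ∪ B → z' ∈ A ∪ B → z ≠ z' →
        D.Reachable (Sum.inr z) (Sum.inr z') →
        ((z ∈ A ∧ z' ∈ A) ∨ (z ∈ B ∧ z' ∈ B))) →
      IsSolution G A B PE) := by
  subst hD
  obtain ⟨n, hn⟩ := exists_isPortEnum G idx hcubic hidx
  let F := usedGraph G idx (symmDiff M₁ M₂)
  have hDpc := deltaGraph_isPathCycleGraph hn hM₁ hM₂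
  have hFpc : F.IsPathCycleGraph ((A ∪ B : Finset V) : Set V) :=
    usedGraph_isPathCycleGraph hn hM₁ hM₂
  have hFG : F ≤ G := usedGraph_le _
  have hmem : ∀ z ∈ A ∪ B, (Sum.inr z : HVert V) ∈ Sum.inr '' ((A ∪ B : Finset V) : Set V) :=
    fun z hz => ⟨z, hz, rfl⟩
  refine ⟨fun ε hε => ?_, fun z hz => ?_, ?_⟩
  · induction ε using Sym2.ind with | _ x a =>
    have hxa : (deltaGraph M₁ M₂).Adj x a := (deltaGraph_adj hM₁ hM₂).2 hε
    by_cases hr : ∃ z ∈ A ∪ B, (deltaGraph M₁ M₂).Reachable x (Sum.inr z)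
    · obtain ⟨z, hz, hr⟩ := hr
      obtain ⟨_, ⟨z', hz', rfl⟩, hne, p, hp, hsp, -⟩ := hDpc.exists_path (hmem z hz)
      exact .inr ⟨z, z', hz, hz', fun h => hne (by rw [h]), p, hp,
        hsp x (hsp.mem_support_iff.2 hr.symm) a hxa, hsp.edges_eq_compEdges⟩
    · push Not at hr
      obtain ⟨c, hc, hsp⟩ := hDpc.exists_cycle hxa (by rintro _ ⟨z, hz, rfl⟩; exact hr z hz)
      exact .inl ⟨x, c, hc, hsp x c.start_mem_support a hxa, hsp.edges_eq_compEdges,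
        fun z hz h => hr z hz (hsp.mem_support_iff.1 h)⟩
  · obtain ⟨_, ⟨z', hz', rfl⟩, hne, p, hp, hsp, hT⟩ := hDpc.exists_path (hmem z hz)
    refine ⟨z', ⟨hz', fun h => hne (by rw [h]), p, hp, hsp.edges_eq_compEdges⟩, ?_⟩
    rintro w ⟨hw, hwz, q, -⟩
    rcases hT _ (hmem w hw) (hsp.mem_support_iff.2 q.reachable) with h | h
    · exact absurd (Sum.inr_injective h) hwz
    · exact Sum.inr_injective h
  obtain ⟨f, hf, hfT, hfinj, hfsurj⟩ := hFpc.exists_pathFamily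
  obtain ⟨m, g, hg, hginj, hgsurj⟩ := hFpc.exists_cycleFamily
  let f' : Fin ((A ∪ B).card / 2) → (u : V) × (v : V) × G.Walk u v :=
    fun i => ⟨(f i).1, (f i).2.1, (f i).2.2.mapLe hFG⟩
  let g' : Fin m → (x : V) × G.Walk x x := fun j => ⟨(g j).1, (g j).2.mapLe hFG⟩
  have hfs : ∀ i x, x ∈ (f' i).2.2.support ↔ F.Reachable (f i).1 x := fun i x => by
    rw [SimpleGraph.Walk.support_mapLe_eq_support, (hf i).2.mem_support_iff]
  have hgs : ∀ j x, x ∈ (g' j).2.support ↔ F.Reachable (g j).1 x := fun j x => by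
    rw [SimpleGraph.Walk.support_mapLe_eq_support, (hg j).2.1.mem_support_iff]
  have hfe : ∀ i, {e | e ∈ (f' i).2.2.edges} = compEdges F (f i).1 := fun i => by
    simp only [f', SimpleGraph.Walk.edges_mapLe_eq_edges, (hf i).2.edges_eq_compEdges]
  have hge : ∀ j, {e | e ∈ (g' j).2.edges} = compEdges F (g j).1 := fun j => by
    simp only [g', SimpleGraph.Walk.edges_mapLe_eq_edges, (hg j).2.1.edges_eq_compEdges]
  have hpath : ∀ i, (f' i).2.2.IsPath := fun i => (hf i).1.mapLe hFG
  have hends : ∀ i, (f' i).1 ∈ A ∪ B ∧ (f' i).2.1 ∈ A ∪ B ∧ (f' i).1 ≠ (f' i).2.1 ∧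
      (deltaGraph M₁ M₂).Reachable (Sum.inr (f' i).1) (Sum.inr (f' i).2.1) := fun i => by
    obtain ⟨h1, h2, h3⟩ := hfT i
    obtain ⟨a, ha⟩ := exists_deltaGraph_adj_inr hn hM₁ hM₂ h2
    exact ⟨h1, h2, h3, (reachable_inr_iff hn hM₁ hM₂ h1 ha).2 (f i).2.2.reachable⟩
  have hdisjoint : ∀ i j, i ≠ j → ∀ x, x ∈ (f' i).2.2.support → x ∉ (f' j).2.2.support := by
    intro i j hij x hx hx'
    rw [hfs] at hx hx'
    exact hij (hfinj i j (hx.trans hx'.symm))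
  have hunion : (⋃ i, {e | e ∈ (f' i).2.2.edges}) = PE := by
    ext e
    simp only [hfe, hPE, Set.mem_iUnion]
    constructor
    · rintro ⟨i, hi⟩
      rw [compEdges_usedGraph hn hM₁ hM₂ (hfT i).1] at hi
      exact ⟨hi.1, hi.2.1, _, (hfT i).1, hi.2.2⟩
    · rintro ⟨he, heΔ, z, hz, hr⟩
      obtain ⟨u, hu, hr⟩ := (exists_mem_extEdge_reachable_iff hn hM₁ hM₂ hz heΔ).1 hr
      obtain ⟨i, hi⟩ := hfsurj z hz
      refine ⟨i, mem_edgeSet_usedGraph.2 ⟨he, heΔ⟩, u, hu, ?_⟩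
      rcases hi with rfl | rfl
      · exact hr
      · exact (f i).2.2.reachable.trans hr
  refine ⟨⟨f', m, g', hpath, hends, fun i => ?_, hdisjoint, hfsurj, hunion,
    fun j => (hg j).1.mapLe hFG, fun j j' hjj x hx hx' => ?_, fun i j x hx hx' => ?_, ?_⟩,
    fun hAB => ?_⟩
  · rw [hfe, compEdges_usedGraph hn hM₁ hM₂ (hfT i).1]
  · rw [hgs] at hx hx'
    exact hjj (hginj j j' (hx.trans hx'.symm))
  · rw [hfs] at hx
    rw [hgs] at hx'
    exact (hg j).2.2 _ (hfT i).1 (hx'.trans hx.symm)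
  · ext e
    simp only [hge, hCE, Set.mem_iUnion]
    constructor
    · rintro ⟨j, he, u, hu, hr⟩
      obtain ⟨heG, heΔ⟩ := mem_edgeSet_usedGraph.1 he
      refine ⟨heG, heΔ, fun z hz y hy hzy => ?_⟩
      obtain ⟨w, hw, hzw⟩ :=
        (exists_mem_extEdge_reachable_iff hn hM₁ hM₂ hz heΔ).1 ⟨y, hy, hzy⟩
      have huw : F.Reachable u w := by
        by_cases huw : u = w
        · exact huw ▸ SimpleGraph.Reachable.refl _
        · obtain rfl := ((Sym2.mem_and_mem_iff huw).1 ⟨hu, hw⟩)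
          exact SimpleGraph.Adj.reachable he
      exact (hg j).2.2 z hz (hr.trans (huw.trans hzw.symm))
    · rintro ⟨heG, heΔ, hno⟩
      induction e using Sym2.ind with | _ u w =>
      have hadj : F.Adj u w := ⟨heG, heΔ⟩
      obtain ⟨j, hj⟩ := hgsurj u w hadj fun z hz hr => by
        obtain ⟨y, hy, hzy⟩ := (exists_mem_extEdge_reachable_iff hn hM₁ hM₂ hz heΔ).2
          ⟨u, by simp, hr.symm⟩
        exact hno z hz y hy hzy
      exact ⟨j, hadj, u, by simp, hj⟩
  · refine ⟨_, f', by rw [Finset.card_union_of_disjoint hdisj], hpath, fun i => ?_, hdisjoint,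
      hfsurj, hunion.symm⟩
    obtain ⟨h1, h2, h3, h4⟩ := hends i
    exact hAB _ _ h1 h2 h3 h4
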